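/- With the channel setup below, the following determinant inequality holds: det(I_{N1} + (ρ21/M2)·H21·H21† + (ρ11/M1)·H11·H11†) ≥ det(I_{N1} + ρ21·H21·H21† + ρ11·H11·H11†) · det(I_{N1} + ρ21·H21·K2u·H21†) / ( (max(M1,M2))^{min(N1, M1+M2)} · ((M2+1)/M2)^{min(M2,N1)} ), where all determinants are positive real numbers. -/

import Mathlib

open Matrix ComplexOrder

/-- `KK H ρ = (I + ρ·H†·H)⁻¹`. -/
noncomputable def KK {m n : ℕ} (H : Matrix (Fin n) (Fin m) ℂ) (ρ : ℝ) :
    Matrix (Fin m) (Fin m) ℂ :=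
  (1 + (ρ : ℂ) • (Hᴴ * H))⁻¹

/-- `Ku H ρ = (1/m)·(I + ρ·H†·H)⁻¹` where `m` is the column dimension. -/
noncomputable def Ku {m n : ℕ} (H : Matrix (Fin n) (Fin m) ℂ) (ρ : ℝ) :
    Matrix (Fin m) (Fin m) ℂ :=
  ((m : ℂ))⁻¹ • KK H ρ

namespace Matrix

variable {m n : Type*} [Fintype m] [Fintype n] [DecidableEq m] [DecidableEq n]

lemma PosSemidef.one_le_det_one_add {Q : Matrix n n ℂ} (hQ : Q.PosSemidef) :
    1 ≤ (1 + Q).det := by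
  have h : (1 + Q).det = ∏ i, (1 + (hQ.1.eigenvalues i : ℂ)) := by
    conv_lhs => rw [hQ.1.spectral_theorem]
    rw [← map_one (Unitary.conjStarAlgAut ℂ _ hQ.1.eigenvectorUnitary), ← map_add,
      Unitary.conjStarAlgAut_apply, det_mul_comm, ← mul_assoc, Unitary.coe_star_mul_self, one_mul,
      ← diagonal_one, diagonal_add, det_diagonal]
    rfl
  rw [h]
  have h' : (1 : ℝ) ≤ ∏ i, (1 + hQ.1.eigenvalues i) :=
    Finset.one_le_prod fun i _ => le_add_of_nonneg_right (hQ.eigenvalues_nonneg i)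
  exact_mod_cast h'

/-- The determinant is monotone for the Loewner order. -/
lemma PosDef.det_le_det {A B : Matrix n n ℂ} (hA : A.PosDef) (hAB : (B - A).PosSemidef) :
    A.det ≤ B.det := by
  obtain ⟨C, hC⟩ : ∃ C : Matrix n n ℂ, B - A = C * Cᴴ := by
    open scoped MatrixOrder in
    obtain ⟨C, hC⟩ := CStarAlgebra.nonneg_iff_eq_mul_star_self.mp hAB.nonneg
    exact ⟨C, hC⟩
  have hB : B = A + C * Cᴴ := by rw [← hC]; abel
  rw [hB, det_add_mul C Cᴴ ((isUnit_iff_isUnit_det A).mp hA.isUnit)]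
  exact le_mul_of_one_le_right hA.det_pos.le
    (hA.inv.posSemidef.conjTranspose_mul_mul_same C).one_le_det_one_add

lemma PosSemidef.det_one_add_le_pow_mul {P : Matrix n n ℂ} (hP : P.PosSemidef) {c : ℝ}
    (hc : 1 ≤ c) :
    (1 + P).det ≤ (c : ℂ) ^ Fintype.card n * (1 + (c⁻¹ : ℂ) • P).det := by
  have hc0 : (c : ℂ) ≠ 0 := by exact_mod_cast (by positivity : c ≠ 0)
  rw [← det_smul, smul_add, smul_smul, mul_inv_cancel₀ hc0, one_smul]
  refine (PosDef.one.add_posSemidef hP).det_le_det ?_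
  have h : (c : ℂ) • (1 : Matrix n n ℂ) + P - (1 + P) = ((c - 1 : ℝ) : ℂ) • 1 := by
    push_cast
    module
  rw [h]
  exact PosSemidef.one.smul (by exact_mod_cast sub_nonneg.mpr hc)

lemma det_one_add_mul_conjTranspose_le (G : Matrix m n ℂ) {c : ℝ} (hc : 1 ≤ c) :
    (1 + G * Gᴴ).det ≤ (c : ℂ) ^ min (Fintype.card m) (Fintype.card n) *
      (1 + (c⁻¹ : ℂ) • (G * Gᴴ)).det := by
  rcases min_choice (Fintype.card m) (Fintype.card n) with h | h <;> rw [h]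
  · exact (posSemidef_self_mul_conjTranspose G).det_one_add_le_pow_mul hc
  · rw [det_one_add_mul_comm, ← Matrix.smul_mul, det_one_add_mul_comm (_ • G), Matrix.mul_smul]
    exact (posSemidef_conjTranspose_mul_self G).det_one_add_le_pow_mul hc

lemma PosSemidef.det_one_add_smul_le {P : Matrix n n ℂ} (hP : P.PosSemidef)
    (hP1 : (1 - P).PosSemidef) {t : ℝ} (ht : 0 ≤ t) :
    (1 + (t : ℂ) • P).det ≤ (1 + t : ℂ) ^ Fintype.card n := by
  have h : (1 + t : ℂ) ^ Fintype.card n = ((1 + t : ℂ) • (1 : Matrix n n ℂ)).det := by simp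
  have ht' : (0 : ℂ) ≤ t := by exact_mod_cast ht
  rw [h]
  refine (PosDef.one.add_posSemidef (hP.smul ht')).det_le_det ?_
  convert hP1.smul ht' using 1
  module

end Matrix

lemma posDef_one_add_smul {m n : ℕ} (H : Matrix (Fin n) (Fin m) ℂ) {ρ : ℝ} (hρ : 0 ≤ ρ) :
    (1 + (ρ : ℂ) • (Hᴴ * H)).PosDef :=
  PosDef.one.add_posSemidef
    ((posSemidef_conjTranspose_mul_self H).smul (by exact_mod_cast hρ))

lemma one_add_smul_mul_KK {m n : ℕ} (H : Matrix (Fin n) (Fin m) ℂ) {ρ : ℝ} (hρ : 0 ≤ ρ) :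
    (1 + (ρ : ℂ) • (Hᴴ * H)) * KK H ρ = 1 :=
  mul_nonsing_inv _ ((isUnit_iff_isUnit_det _).mp (posDef_one_add_smul H hρ).isUnit)

lemma posDef_KK {m n : ℕ} (H : Matrix (Fin n) (Fin m) ℂ) {ρ : ℝ} (hρ : 0 ≤ ρ) :
    (KK H ρ).PosDef :=
  (posDef_one_add_smul H hρ).inv

/-- Push-through identity. -/
lemma smul_mul_KK_mul_conjTranspose {m n : ℕ} (H : Matrix (Fin n) (Fin m) ℂ) {ρ : ℝ}
    (hρ : 0 ≤ ρ) : (ρ : ℂ) • (H * KK H ρ * Hᴴ) = 1 - KK Hᴴ ρ := by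
  have hK := one_add_smul_mul_KK H hρ
  have hL := mul_eq_one_comm.mp (one_add_smul_mul_KK Hᴴ hρ)
  rw [conjTranspose_conjTranspose] at hL
  have h : H * KK H ρ = KK Hᴴ ρ * H := by
    calc H * KK H ρ = KK Hᴴ ρ * (1 + (ρ : ℂ) • (H * Hᴴ)) * H * KK H ρ := by
          rw [hL, Matrix.one_mul]
      _ = KK Hᴴ ρ * H * ((1 + (ρ : ℂ) • (Hᴴ * H)) * KK H ρ) := by
          simp only [Matrix.mul_add, Matrix.add_mul, Matrix.mul_smul, Matrix.smul_mul,
            Matrix.mul_one, Matrix.one_mul, Matrix.mul_assoc]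
      _ = KK Hᴴ ρ * H := by rw [hK, Matrix.mul_one]
  rw [h, eq_sub_iff_add_eq, ← hL]
  simp only [Matrix.mul_add, Matrix.mul_smul, Matrix.mul_one, Matrix.mul_assoc]
  exact add_comm _ _

lemma posSemidef_one_sub_KK {m n : ℕ} (H : Matrix (Fin n) (Fin m) ℂ) {ρ : ℝ} (hρ : 0 ≤ ρ) :
    (1 - KK H ρ).PosSemidef := by
  have h := smul_mul_KK_mul_conjTranspose Hᴴ hρ
  simp only [conjTranspose_conjTranspose] at h
  rw [← h]
  simpa using ((posDef_KK Hᴴ hρ).posSemidef.conjTranspose_mul_mul_same H).smul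
    (by exact_mod_cast hρ : (0 : ℂ) ≤ ρ)

lemma one_add_smul_mul_Ku {m n : ℕ} (H : Matrix (Fin n) (Fin m) ℂ) {ρ : ℝ} (hρ : 0 ≤ ρ) :
    1 + (ρ : ℂ) • (H * Ku H ρ * Hᴴ) = 1 + (((m : ℝ)⁻¹ : ℝ) : ℂ) • (1 - KK Hᴴ ρ) := by
  rw [← smul_mul_KK_mul_conjTranspose H hρ, Ku, Matrix.mul_smul, Matrix.smul_mul, smul_comm]
  push_cast
  rfl

lemma det_one_add_smul_mul_Ku_le {m n : ℕ} (H : Matrix (Fin n) (Fin m) ℂ) {ρ : ℝ}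
    (hρ : 0 ≤ ρ) :
    (1 + (ρ : ℂ) • (H * Ku H ρ * Hᴴ)).det ≤ (1 + (((m : ℝ)⁻¹ : ℝ) : ℂ)) ^ min m n := by
  have hm : (0 : ℝ) ≤ (m : ℝ)⁻¹ := by positivity
  have aux : ∀ {k l : ℕ} (G : Matrix (Fin l) (Fin k) ℂ),
      (1 + (((m : ℝ)⁻¹ : ℝ) : ℂ) • (1 - KK G ρ)).det ≤ (1 + (((m : ℝ)⁻¹ : ℝ) : ℂ)) ^ k :=
    fun {k l} G => by
      simpa using (posSemidef_one_sub_KK G hρ).det_one_add_smul_le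
        (by simpa using (posDef_KK G hρ).posSemidef) hm
  rw [one_add_smul_mul_Ku H hρ]
  rcases min_choice m n with h | h <;> rw [h]
  · have hdet : (1 + (((m : ℝ)⁻¹ : ℝ) : ℂ) • (1 - KK Hᴴ ρ)).det =
        (1 + (((m : ℝ)⁻¹ : ℝ) : ℂ) • (1 - KK H ρ)).det := by
      have hK := one_add_smul_mul_KK H hρ
      rw [Matrix.add_mul, Matrix.one_mul, Matrix.smul_mul, Matrix.mul_assoc,
        ← eq_sub_iff_add_eq'] at hK
      rw [← smul_mul_KK_mul_conjTranspose H hρ, ← hK, smul_smul, ← Matrix.smul_mul,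
        det_one_add_mul_comm, Matrix.mul_smul, smul_smul]
    rw [hdet]
    exact aux H
  · exact aux Hᴴ

lemma det_one_add_smul_add_smul_le {k l n : ℕ} (A : Matrix (Fin n) (Fin k) ℂ)
    (B : Matrix (Fin n) (Fin l) ℂ) {a b c : ℝ} (ha : 0 ≤ a) (hb : 0 ≤ b) (hc : 1 ≤ c) :
    (1 + (a : ℂ) • (A * Aᴴ) + (b : ℂ) • (B * Bᴴ)).det ≤ (c : ℂ) ^ min n (l + k) *
      (1 + ((a / c : ℝ) : ℂ) • (A * Aᴴ) + ((b / c : ℝ) : ℂ) • (B * Bᴴ)).det := by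
  have hG : ∀ {j : ℕ} (M : Matrix (Fin n) (Fin j) ℂ) {r : ℝ}, 0 ≤ r →
      ((√r : ℝ) : ℂ) • M * (((√r : ℝ) : ℂ) • M)ᴴ = (r : ℂ) • (M * Mᴴ) := fun M r hr => by
    rw [conjTranspose_smul, Matrix.smul_mul, Matrix.mul_smul, smul_smul, Complex.star_def,
      Complex.conj_ofReal, ← Complex.ofReal_mul, Real.mul_self_sqrt hr]
  have h := det_one_add_mul_conjTranspose_le
    (fromCols (((√b : ℝ) : ℂ) • B) (((√a : ℝ) : ℂ) • A)) hc
  rw [conjTranspose_fromCols_eq_fromRows_conjTranspose, fromCols_mul_fromRows, hG A ha, hG B hb]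
    at h
  convert h using 2
  · abel_nf
  · simp
  · congr 1
    push_cast
    module

/-- With `K2u = (1/M2)·(I_{M2}+ρ21·H21†H21)⁻¹`:
`det(I + (ρ21/M2)·H21·H21† + (ρ11/M1)·H11·H11†) ≥
 det(I + ρ21·H21·H21† + ρ11·H11·H11†)·det(I + ρ21·H21·K2u·H21†)
  / ((max(M1,M2))^{min(N1,M1+M2)}·((M2+1)/M2)^{min(M2,N1)})`. -/
theorem stmt_11 (M1 M2 N1 N2 : ℕ) (hM1 : 0 < M1) (hM2 : 0 < M2) (hN1 : 0 < N1) (hN2 : 0 < N2)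
    (H11 : Matrix (Fin N1) (Fin M1) ℂ) (H21 : Matrix (Fin N1) (Fin M2) ℂ)
    (H12 : Matrix (Fin N2) (Fin M1) ℂ) (H22 : Matrix (Fin N2) (Fin M2) ℂ)
    (ρ11 ρ12 ρ21 ρ22 : ℝ) (h11 : 0 ≤ ρ11) (h12 : 0 ≤ ρ12) (h21 : 0 ≤ ρ21) (h22 : 0 ≤ ρ22) :
    ((1 + (ρ21 : ℂ) • (H21 * H21ᴴ) + (ρ11 : ℂ) • (H11 * H11ᴴ)).det).re
        * ((1 + (ρ21 : ℂ) • (H21 * Ku H21 ρ21 * H21ᴴ)).det).re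
        / (((max M1 M2 : ℕ) : ℝ) ^ (min N1 (M1 + M2))
            * (((M2 : ℝ) + 1) / M2) ^ (min M2 N1))
      ≤ ((1 + ((ρ21 / M2 : ℝ) : ℂ) • (H21 * H21ᴴ)
          + ((ρ11 / M1 : ℝ) : ℂ) • (H11 * H11ᴴ)).det).re := by
  set c : ℝ := ((max M1 M2 : ℕ) : ℝ)
  have hc1 : (M1 : ℝ) ≤ c := by exact Nat.cast_le.mpr (le_max_left M1 M2)
  have hc2 : (M2 : ℝ) ≤ c := by exact Nat.cast_le.mpr (le_max_right M1 M2)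
  have hM1' : (0 : ℝ) < M1 := by exact_mod_cast hM1
  have hM2' : (0 : ℝ) < M2 := by exact_mod_cast hM2
  have hc : 1 ≤ c := le_trans (by exact_mod_cast hM1) hc1
  have hpsd : ∀ {j : ℕ} (M : Matrix (Fin N1) (Fin j) ℂ) {r : ℝ}, 0 ≤ r →
      ((r : ℂ) • (M * Mᴴ)).PosSemidef := fun M r hr =>
    (posSemidef_self_mul_conjTranspose M).smul (by exact_mod_cast hr)
  have hscale := det_one_add_smul_add_smul_le H21 H11 h21 h11 hc
  have hKu := det_one_add_smul_mul_Ku_le H21 h21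
  have hmono : (1 + ((ρ21 / c : ℝ) : ℂ) • (H21 * H21ᴴ)
      + ((ρ11 / c : ℝ) : ℂ) • (H11 * H11ᴴ)).det ≤ (1 + ((ρ21 / M2 : ℝ) : ℂ) • (H21 * H21ᴴ)
      + ((ρ11 / M1 : ℝ) : ℂ) • (H11 * H11ᴴ)).det := by
    refine ((PosDef.one.add_posSemidef (hpsd H21 (by positivity))).add_posSemidef
      (hpsd H11 (by positivity))).det_le_det ?_
    convert (hpsd H21 (sub_nonneg.mpr (div_le_div_of_nonneg_left h21 hM2' hc2))).add
      (hpsd H11 (sub_nonneg.mpr (div_le_div_of_nonneg_left h11 hM1' hc1))) using 1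
    rw [Complex.ofReal_sub, Complex.ofReal_sub]
    module
  have hpos : 0 ≤ (1 + (ρ21 : ℂ) • (H21 * H21ᴴ) + (ρ11 : ℂ) • (H11 * H11ᴴ)).det :=
    ((PosSemidef.one.add (hpsd H21 h21)).add (hpsd H11 h11)).det_nonneg
  have hscale' := (Complex.le_def.mp hscale).1
  have hKu' := (Complex.le_def.mp hKu).1
  have hmono' := (Complex.le_def.mp hmono).1
  have hpos' := (Complex.le_def.mp hpos).1
  rw [← Complex.ofReal_pow, Complex.re_ofReal_mul] at hscale'
  have hM2e : 1 + (M2 : ℝ)⁻¹ = ((M2 : ℝ) + 1) / M2 := by field_simp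
  rw [← Complex.ofReal_one, ← Complex.ofReal_add, ← Complex.ofReal_pow, Complex.ofReal_re,
    hM2e] at hKu'
  rw [div_le_iff₀ (by positivity)]
  refine (mul_le_mul_of_nonneg_left hKu' hpos').trans ?_
  rw [← mul_assoc]
  refine mul_le_mul_of_nonneg_right (hscale'.trans ?_) (by positivity)
  rw [mul_comm]
  exact mul_le_mul_of_nonneg_right hmono' (by positivity)
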